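/- Let Γ be an n-vertex connected nonregular finite simple graph whose adjacency matrix has exactly three distinct eigenvalues s > 1 > −t, which is not a cone and not biregular. Then t ≤ 29. -/

import Mathlib

namespace ThreeEigenvalues

open Finset Matrix

variable {V : Type} [DecidableEq V] {G : SimpleGraph V} [DecidableRel G.Adj]

theorem card_sdiff_real (S T : Finset V) : (#(S \ T) : ℝ) = #S - #(S ∩ T) := by
  have := card_sdiff_add_card_inter S T
  rw [← this]; push_cast; ring

/-- The entries of `A - 1`. -/
def shifted (G : SimpleGraph V) [DecidableRel G.Adj] (x y : V) : ℝ :=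
  (if G.Adj x y then 1 else 0) - (if x = y then 1 else 0)

theorem shifted_self (x : V) : shifted G x x = -1 := by simp [shifted]

theorem shifted_of_adj {x y : V} (h : G.Adj x y) : shifted G x y = 1 := by
  simp [shifted, h, h.ne]

theorem shifted_of_not_adj {x y : V} (hne : x ≠ y) (h : ¬ G.Adj x y) : shifted G x y = 0 := by
  simp [shifted, h, hne]

theorem shifted_nonneg {x y : V} (hne : x ≠ y) : 0 ≤ shifted G x y := by
  unfold shifted
  rw [if_neg hne]
  split_ifs <;> norm_num

theorem card_le_of_isIndepSet {k : ℕ} {B : Matrix V (Fin k) ℝ} {C : Matrix (Fin k) V ℝ}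
    (hBC : 1 - G.adjMatrix ℝ = B * C) (S : Finset V)
    (hS : ∀ x ∈ S, ∀ y ∈ S, ¬ G.Adj x y) : #S ≤ k := by
  have : (1 : Matrix S S ℝ) = B.submatrix (fun x : S => (x : V)) id *
      C.submatrix id (fun x : S => (x : V)) := by
    ext x y
    have := congrFun (congrFun hBC x) y
    rw [Matrix.mul_apply] at this ⊢
    simp only [submatrix_apply, id]
    rw [← this]
    by_cases hxy : x = y
    · subst hxy; simp
    · have hne : (x : V) ≠ y := fun e => hxy (Subtype.ext e)
      simp [hS x x.2 y y.2, hxy, hne]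
  have h1 := rank_mul_le_left (B.submatrix (fun x : S => (x : V)) id)
    (C.submatrix id (fun x : S => (x : V)))
  rw [← this, rank_one, Fintype.card_coe] at h1
  have h2 := rank_le_card_width (B.submatrix (fun x : S => (x : V)) id)
  rw [Fintype.card_fin] at h2
  exact h1.trans h2

variable [Fintype V] {s t : ℝ} {α : V → ℝ}

/-- The spectral decomposition of a graph with eigenvalues `s`, `1`, `-t`, the first of them simple
with positive eigenvector `α`, normalised so that `(A - 1)(A + t) = α αᵀ`. -/
structure Decomposition (G : SimpleGraph V) [DecidableRel G.Adj] (s t : ℝ) (α : V → ℝ) :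
    Prop where
  pos : ∀ x, 0 < α x
  key : G.adjMatrix ℝ * G.adjMatrix ℝ + (t - 1) • G.adjMatrix ℝ - t • (1 : Matrix V V ℝ)
    = vecMulVec α α
  eig : G.adjMatrix ℝ *ᵥ α = s • α

local notation "Nb" => SimpleGraph.neighborFinset G

theorem adjMatrix_sq_apply (x y : V) :
    (G.adjMatrix ℝ * G.adjMatrix ℝ) x y = (#(Nb x ∩ Nb y) : ℝ) := by
  rw [SimpleGraph.adjMatrix_mul_apply]
  simp only [SimpleGraph.adjMatrix_apply, sum_boole]
  congr 2
  ext u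
  simp [SimpleGraph.adj_comm]

theorem Decomposition.card_inter (h : Decomposition G s t α) (x y : V) :
    (#(Nb x ∩ Nb y) : ℝ) + (t - 1) * (if G.Adj x y then 1 else 0) - t * (if x = y then 1 else 0)
      = α x * α y := by
  have := congrFun (congrFun h.key x) y
  simpa only [Matrix.sub_apply, Matrix.add_apply, adjMatrix_sq_apply, Matrix.smul_apply,
    SimpleGraph.adjMatrix_apply, Matrix.one_apply, smul_eq_mul, vecMulVec_apply] using this

theorem Decomposition.degree (h : Decomposition G s t α) (x : V) :
    (#(Nb x) : ℝ) = α x ^ 2 + t := by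
  have := h.card_inter x x
  simp only [inter_self, SimpleGraph.irrefl, if_false, if_true] at this
  linarith

theorem Decomposition.card_inter_adj (h : Decomposition G s t α) {x y : V} (hxy : G.Adj x y) :
    (#(Nb x ∩ Nb y) : ℝ) = α x * α y + 1 - t := by
  have := h.card_inter x y
  simp only [hxy, hxy.ne, if_false, if_true] at this
  linarith

theorem Decomposition.card_inter_not_adj (h : Decomposition G s t α) {x y : V} (hne : x ≠ y)
    (hxy : ¬ G.Adj x y) : (#(Nb x ∩ Nb y) : ℝ) = α x * α y := by
  have := h.card_inter x y
  simp only [hxy, hne, if_false] at this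
  linarith

theorem Decomposition.card_sdiff_adj (h : Decomposition G s t α) {x y : V} (hxy : G.Adj x y) :
    (#(Nb x \ Nb y) : ℝ) = 2 * t - 1 + α x * (α x - α y) := by
  rw [card_sdiff_real, h.degree, h.card_inter_adj hxy]; ring

theorem Decomposition.card_sdiff_not_adj (h : Decomposition G s t α) {x y : V} (hne : x ≠ y)
    (hxy : ¬ G.Adj x y) : (#(Nb x \ Nb y) : ℝ) = t + α x * (α x - α y) := by
  rw [card_sdiff_real, h.degree, h.card_inter_not_adj hne hxy]; ring

theorem Decomposition.le_of_not_adj (h : Decomposition G s t α) {x y : V} (hne : x ≠ y)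
    (hxy : ¬ G.Adj x y) : α x * (α y - α x) ≤ t := by
  have := h.card_sdiff_not_adj hne hxy
  have h0 : (0 : ℝ) ≤ #(Nb x \ Nb y) := by positivity
  linarith

theorem Decomposition.le_of_adj (h : Decomposition G s t α) {x y : V}
    (hxy : G.Adj x y) : α x * (α y - α x) ≤ 2 * t - 2 := by
  have := h.card_sdiff_adj hxy
  have h0 : 1 ≤ #(Nb x \ Nb y) := card_pos.2 ⟨y, by simpa using hxy⟩
  have h0 : (1 : ℝ) ≤ #(Nb x \ Nb y) := by exact_mod_cast h0
  linarith

theorem Decomposition.le_mul_of_adj (h : Decomposition G s t α) {x y : V}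
    (hxy : G.Adj x y) : t - 1 ≤ α x * α y := by
  have := h.card_inter_adj hxy
  have h0 : (0 : ℝ) ≤ #(Nb x ∩ Nb y) := by positivity
  linarith

theorem Decomposition.sq_shifted (h : Decomposition G s t α) :
    (G.adjMatrix ℝ - 1) * (G.adjMatrix ℝ - 1) + (t + 1) • (G.adjMatrix ℝ - 1)
      = vecMulVec α α := by
  rw [← h.key, sub_mul, mul_sub, mul_sub, mul_one, one_mul, one_mul]
  module

theorem shifted_dot_comm (f g : V → ℝ) :
    f ⬝ᵥ ((G.adjMatrix ℝ - 1) *ᵥ g) = g ⬝ᵥ ((G.adjMatrix ℝ - 1) *ᵥ f) := by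
  have hM : (G.adjMatrix ℝ - 1)ᵀ = G.adjMatrix ℝ - 1 := by
    simp
  rw [dotProduct_comm, ← vecMul_transpose, hM, ← dotProduct_mulVec]

theorem Decomposition.form_nonpos_of_orthogonal (h : Decomposition G s t α) (ht : 0 < t + 1)
    (g : V → ℝ) (hg : α ⬝ᵥ g = 0) : g ⬝ᵥ ((G.adjMatrix ℝ - 1) *ᵥ g) ≤ 0 := by
  have e := congrArg (fun K => g ⬝ᵥ (K *ᵥ g)) h.sq_shifted
  simp only [add_mulVec, smul_mulVec, dotProduct_add, dotProduct_smul, vecMulVec_mulVec, hg,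
    ← mulVec_mulVec] at e
  rw [shifted_dot_comm] at e
  have h0 : 0 ≤ ((G.adjMatrix ℝ - 1) *ᵥ g) ⬝ᵥ ((G.adjMatrix ℝ - 1) *ᵥ g) :=
    dotProduct_self_star_nonneg (R := ℝ) _
  simp at e
  nlinarith

theorem Decomposition.form_nonpos (h : Decomposition G s t α) (ht : 0 < t + 1) {x y : V}
    (hxy : G.Adj x y) (f : V → ℝ)
    (hf : ((G.adjMatrix ℝ - 1) *ᵥ f) x + ((G.adjMatrix ℝ - 1) *ᵥ f) y = 0) :
    f ⬝ᵥ ((G.adjMatrix ℝ - 1) *ᵥ f) ≤ 0 := by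
  have hp : 0 < α x + α y := add_pos (h.pos x) (h.pos y)
  set e : V → ℝ := Pi.single x 1 + Pi.single y 1 with he
  have he1 : ∀ g : V → ℝ, e ⬝ᵥ g = g x + g y := fun g => by
    simp [he, add_dotProduct]
  set c := (α ⬝ᵥ f) / (α x + α y) with hc
  have hee : e ⬝ᵥ ((G.adjMatrix ℝ - 1) *ᵥ e) = 0 := by
    rw [he1, he]
    simp [mulVec_add, hxy, hxy.symm, hxy.ne, hxy.ne']
  have hg := h.form_nonpos_of_orthogonal ht (f - c • e) (by
    rw [dotProduct_sub, dotProduct_smul, dotProduct_comm α e, he1, hc, smul_eq_mul]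
    field_simp; ring)
  have hef : e ⬝ᵥ ((G.adjMatrix ℝ - 1) *ᵥ f) = 0 := by rw [he1, hf]
  have hfe := hef
  rw [shifted_dot_comm] at hfe
  rw [mulVec_sub, mulVec_smul, sub_dotProduct, dotProduct_sub, dotProduct_sub, smul_dotProduct,
    smul_dotProduct, dotProduct_smul, dotProduct_smul, hee, hef, hfe] at hg
  simpa using hg

theorem Decomposition.sum_shifted_nonpos (h : Decomposition G s t α) (ht : 0 < t + 1) {x y : V}
    (hxy : G.Adj x y) {k : ℕ} (c : Fin k → ℝ) (v : Fin k → V)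
    (hf : ∑ i, c i * (shifted G x (v i) + shifted G y (v i)) = 0) :
    ∑ i, ∑ j, c i * c j * shifted G (v i) (v j) ≤ 0 := by
  have hM : ∀ a b, (G.adjMatrix ℝ - 1) a b = shifted G a b := fun a b => by
    simp [shifted, Matrix.one_apply]
  have hmul : ∀ a, ((G.adjMatrix ℝ - 1) *ᵥ (∑ i, c i • Pi.single (v i) 1)) a
      = ∑ i, c i * shifted G a (v i) := fun a => by
    simp only [mulVec_sum, Finset.sum_apply, mulVec_smul, mulVec_single_one, Pi.smul_apply,
      smul_eq_mul, col_apply, hM]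
  have := h.form_nonpos ht hxy (∑ i, c i • Pi.single (v i) 1) (by
    rw [hmul, hmul, ← hf, ← sum_add_distrib]
    exact sum_congr rfl fun i _ => by ring)
  rw [sum_dotProduct] at this
  convert this using 2 with i
  rw [smul_dotProduct, single_one_dotProduct, hmul, smul_eq_mul, mul_sum]
  exact sum_congr rfl fun j _ => by ring

/-- A vertex nonadjacent to both ends of an edge has at most one neighbour nonadjacent to both. -/
theorem Decomposition.card_le_one (h : Decomposition G s t α) (ht : 0 < t + 1) {x y z : V}
    (hxy : G.Adj x y) (hzx : z ≠ x) (hzy : z ≠ y) (hx : ¬ G.Adj x z) (hy : ¬ G.Adj y z) :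
    #((Nb z \ Nb x) \ Nb y) ≤ 1 := by
  by_contra hcon
  obtain ⟨u, hu, w, hw, huw⟩ := one_lt_card.1 (not_le.1 hcon)
  simp only [mem_sdiff, SimpleGraph.mem_neighborFinset] at hu hw
  have hux : u ≠ x := by rintro rfl; exact hx hu.1.1.symm
  have huy : u ≠ y := by rintro rfl; exact hy hu.1.1.symm
  have hwx : w ≠ x := by rintro rfl; exact hx hw.1.1.symm
  have hwy : w ≠ y := by rintro rfl; exact hy hw.1.1.symm
  have := h.sum_shifted_nonpos ht hxy ![3, 2, 2] ![z, u, w] (by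
    simp [Fin.sum_univ_three, shifted_of_not_adj, hx, hy, hzx.symm, hzy.symm, hu.1.2, hu.2,
      hw.1.2, hw.2, hux.symm, huy.symm, hwx.symm, hwy.symm])
  simp [Fin.sum_univ_three, shifted_self, shifted_of_adj, hu.1.1, hw.1.1, hu.1.1.symm,
    hw.1.1.symm] at this
  have h1 := shifted_nonneg (G := G) huw
  have h2 := shifted_nonneg (G := G) huw.symm
  linarith

theorem Decomposition.card_common (h : Decomposition G s t α) {x y z : V}
    (hxy : G.Adj x y) (hzx : z ≠ x) (hzy : z ≠ y) (hx : ¬ G.Adj x z) (hy : ¬ G.Adj y z) :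
    (#((Nb x ∩ Nb y) \ Nb z) : ℝ) ≤ (α z - α x) * (α z - α y) + 1 := by
  have e1 := card_sdiff_real (Nb x ∩ Nb y) (Nb z)
  have e2 := card_sdiff_real (Nb z \ Nb x) (Nb y)
  have e3 := card_sdiff_real (Nb z) (Nb x)
  have e4 := card_sdiff_real (Nb z ∩ Nb y) (Nb x)
  have r1 : (Nb z \ Nb x) ∩ Nb y = (Nb z ∩ Nb y) \ Nb x := by grind
  have r2 : (Nb z ∩ Nb y) ∩ Nb x = (Nb x ∩ Nb y) ∩ Nb z := by grind
  have f0 : (0 : ℝ) ≤ #((Nb z \ Nb x) \ Nb y) := by positivity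
  have f1 := h.card_inter_not_adj hzx (fun h' => hx h'.symm)
  have f2 := h.card_inter_not_adj hzy (fun h' => hy h'.symm)
  have f3 := h.card_inter_adj hxy
  have f4 := h.degree z
  rw [r1] at e2
  rw [r2] at e4
  nlinarith

theorem Decomposition.not_forall_not_adj (h : Decomposition G s t α) (ht : 30 ≤ t) {x y z : V}
    (hxy : G.Adj x y) (hlt : α y < α x) (hzx : z ≠ x) (hz : ¬ G.Adj x z)
    (H : ∀ v, v ≠ x → ¬ G.Adj x v → G.Adj v y ∧ α v = α x) : False := by
  have hcz := h.card_sdiff_not_adj hzx (fun h' => hz h'.symm)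
  rw [(H z hzx hz).2, sub_self, mul_zero, add_zero] at hcz
  have hpos : 0 < #(Nb z \ Nb x) := by
    have : (0 : ℝ) < #(Nb z \ Nb x) := by linarith
    exact_mod_cast this
  obtain ⟨w, hw⟩ := card_pos.1 hpos
  simp only [mem_sdiff, SimpleGraph.mem_neighborFinset] at hw
  have hwx : w ≠ x := by rintro rfl; exact hz hw.1.symm
  have hcw := h.card_sdiff_not_adj hwx (fun h' => hw.2 h'.symm)
  rw [(H w hwx hw.2).2, sub_self, mul_zero, add_zero] at hcw
  have hcom := h.card_common hw.1 hzx.symm hwx.symm (fun h' => hz h'.symm) (fun h' => hw.2 h'.symm)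
  rw [(H z hzx hz).2, sub_self, zero_mul, zero_add] at hcom
  have hy := h.card_sdiff_adj hxy.symm
  have hsub : (Nb z \ Nb x) ∪ (Nb w \ Nb x) ⊆ (Nb y \ Nb x).erase x := by
    intro v hv
    simp only [mem_union, mem_sdiff, SimpleGraph.mem_neighborFinset, mem_erase] at hv ⊢
    have hvx : v ≠ x := by
      rintro rfl
      rcases hv with hv | hv
      · exact hz hv.1.symm
      · exact hw.2 hv.1.symm
    have hv' : ¬ G.Adj x v := by tauto
    exact ⟨hvx, (H v hvx hv').1.symm, hv'⟩
  have hcard := card_le_card hsub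
  have hx : x ∈ Nb y \ Nb x := by simpa using hxy.symm
  have he := card_erase_add_one hx
  have hu := card_union_add_card_inter (Nb z \ Nb x) (Nb w \ Nb x)
  have hi : (Nb z \ Nb x) ∩ (Nb w \ Nb x) = (Nb z ∩ Nb w) \ Nb x := by grind
  rw [hi] at hu
  have hu' : (#((Nb z \ Nb x) ∪ (Nb w \ Nb x)) : ℝ) + #((Nb z ∩ Nb w) \ Nb x)
    = #(Nb z \ Nb x) + #(Nb w \ Nb x) := by exact_mod_cast hu
  have he' : (#((Nb y \ Nb x).erase x) : ℝ) + 1 = #(Nb y \ Nb x) := by exact_mod_cast he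
  have hcard' : (#((Nb z \ Nb x) ∪ (Nb w \ Nb x)) : ℝ) ≤ #((Nb y \ Nb x).erase x) := by
    exact_mod_cast hcard
  nlinarith [h.pos y]

/-- The configuration excluded by the Lorentzian signature of the form `A - 1`: an edge `z p`, a
vertex `u` off it with neighbours `a`, `b` and three further neighbours `c`, `d`, `e` of `z`. -/
theorem Decomposition.no_two_claws (h : Decomposition G s t α) (ht : 0 < t + 1)
    {z p u a b c d e : V} (hzp : G.Adj z p) (huz : ¬ G.Adj z u) (huz' : z ≠ u)
    (hpu : ¬ G.Adj p u) (hpu' : p ≠ u)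
    (hza : G.Adj z a) (hzb : G.Adj z b) (hzc : G.Adj z c) (hzd : G.Adj z d) (hze : G.Adj z e)
    (hua : G.Adj u a) (hub : G.Adj u b) (huc : ¬ G.Adj u c) (hud : ¬ G.Adj u d)
    (hue : ¬ G.Adj u e) (hpa : ¬ G.Adj p a) (hpb : ¬ G.Adj p b) (hpc : ¬ G.Adj p c)
    (hpd : ¬ G.Adj p d) (hpe : ¬ G.Adj p e) (hpc' : p ≠ c) (hpd' : p ≠ d) (hpe' : p ≠ e)
    (hac : ¬ G.Adj a c) (had : ¬ G.Adj a d) (hae : ¬ G.Adj a e)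
    (hbc : ¬ G.Adj b c) (hbd : ¬ G.Adj b d) (hbe : ¬ G.Adj b e)
    (hab : a ≠ b) (hcd : c ≠ d) (hce : c ≠ e) (hde : d ≠ e) : False := by
  have hpa' : p ≠ a := by rintro rfl; exact hpu hua.symm
  have hpb' : p ≠ b := by rintro rfl; exact hpu hub.symm
  have huc' : u ≠ c := by rintro rfl; exact huz hzc
  have hud' : u ≠ d := by rintro rfl; exact huz hzd
  have hue' : u ≠ e := by rintro rfl; exact huz hze
  have hac' : a ≠ c := by rintro rfl; exact huc hua
  have had' : a ≠ d := by rintro rfl; exact hud hua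
  have hae' : a ≠ e := by rintro rfl; exact hue hua
  have hbc' : b ≠ c := by rintro rfl; exact huc hub
  have hbd' : b ≠ d := by rintro rfl; exact hud hub
  have hbe' : b ≠ e := by rintro rfl; exact hue hub
  have sym : ∀ x y, shifted G x y = shifted G y x := fun x y => by
    simp [shifted, SimpleGraph.adj_comm, eq_comm]
  have := h.sum_shifted_nonpos ht hzp ![6, 3, 3, -2, -2, -2] ![u, a, b, c, d, e] (by
    simp [Fin.sum_univ_six, shifted_of_not_adj, shifted_of_adj, *]
    norm_num)
  simp [Fin.sum_univ_six, shifted_of_not_adj, shifted_of_adj, shifted_self, sym a u, sym b u,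
    sym b a, sym c u, sym c a, sym c b, sym d u, sym d a, sym d b, sym d c, sym e u, sym e a,
    sym e b, sym e c, sym e d, huc, hua, hub, hud, hue, hac, had, hae, hbc, hbd, hbe,
    huc', hud', hue', hac', had', hae', hbc', hbd', hbe'] at this
  have h1 := shifted_nonneg (G := G) hab
  have h2 := shifted_nonneg (G := G) hcd
  have h3 := shifted_nonneg (G := G) hce
  have h4 := shifted_nonneg (G := G) hde
  linarith

theorem Decomposition.sub_le_of_not_adj (h : Decomposition G s t α) (ht : 30 ≤ t) {x y : V}
    (hne : x ≠ y) (hxy : ¬ G.Adj x y)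
    (hy : (t - 1) / 2 < α y) : α x - α y ≤ 60 / 29 := by
  have h1 := h.le_of_not_adj hne.symm (fun h' => hxy h'.symm)
  by_contra hcon
  nlinarith

theorem Decomposition.high_of_minimal (h : Decomposition G s t α) (ht : 30 ≤ t)
    (hl : ∀ v, α v < 4 ∨ (t - 1) / 2 < α v) {y z : V} (hyz : ¬ G.Adj y z)
    (hne : y ≠ z) (hy : (t - 1) / 2 < α y) (hd : α y + 1 ≤ α z)
    (hmin : ∀ p, (t - 1) / 2 < α p → p ≠ y → ¬ G.Adj y p → α y ≤ α p) {p : V}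
    (hzp : G.Adj z p) (hyp : ¬ G.Adj y p) :
    α y ≤ α p ∧ #((Nb z ∩ Nb p) \ Nb y) ≤ 5 ∧
      (#((Nb z ∩ Nb p) \ Nb y) : ℝ) ≤ 60 / 29 * (α z - α y) + 1 := by
  have hpy : p ≠ y := by rintro rfl; exact hyz hzp.symm
  have hc := h.card_common hzp hne hpy.symm (fun h' => hyz h'.symm) (fun h' => hyp h'.symm)
  have h0 : (0 : ℝ) ≤ #((Nb z ∩ Nb p) \ Nb y) := by positivity
  have hhigh : (t - 1) / 2 < α p := by
    rcases hl p with hp | hp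
    · nlinarith
    · exact hp
  have hle := hmin p hhigh hpy hyp
  have h1 := h.sub_le_of_not_adj ht hpy (fun h' => hyp h'.symm) hy
  have h2 := h.sub_le_of_not_adj ht hne.symm (fun h' => hyz h'.symm) hy
  have h3 : (#((Nb z ∩ Nb p) \ Nb y) : ℝ) ≤ 60 / 29 * (α z - α y) + 1 := by nlinarith
  refine ⟨hle, ?_, h3⟩
  have : (#((Nb z ∩ Nb p) \ Nb y) : ℝ) < 6 := by linarith
  have : #((Nb z ∩ Nb p) \ Nb y) < 6 := by exact_mod_cast this
  omega

/-- Second neighbours of `z` inside the non-neighbourhood of `y` are plentiful. -/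
theorem Decomposition.card_second_neighbors (h : Decomposition G s t α) (ht : 30 ≤ t)
    (hl : ∀ v, α v < 4 ∨ (t - 1) / 2 < α v) {y z : V} (hyz : ¬ G.Adj y z)
    (hne : y ≠ z) (hy : (t - 1) / 2 < α y) (hd : α y + 1 ≤ α z)
    (hmin : ∀ p, (t - 1) / 2 < α p → p ≠ y → ¬ G.Adj y p → α y ≤ α p) {p : V}
    (hzp : G.Adj z p) (hyp : ¬ G.Adj y p) :
    2 ≤ #(((Nb p \ Nb y) \ Nb z).erase z) := by
  obtain ⟨hle, h5, -⟩ := h.high_of_minimal ht hl hyz hne hy hd hmin hzp hyp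
  have hpy : p ≠ y := by rintro rfl; exact hyz hzp.symm
  have hc := h.card_sdiff_not_adj hpy (fun h' => hyp h'.symm)
  have h30 : (30 : ℝ) ≤ #(Nb p \ Nb y) := by nlinarith [h.pos p]
  have h30 : 30 ≤ #(Nb p \ Nb y) := by exact_mod_cast h30
  have h1 := card_sdiff_add_card_inter (Nb p \ Nb y) (Nb z)
  have hi : (Nb p \ Nb y) ∩ Nb z = (Nb z ∩ Nb p) \ Nb y := by grind
  rw [hi] at h1
  have h2 := pred_card_le_card_erase (s := (Nb p \ Nb y) \ Nb z) (a := z)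
  omega

theorem Decomposition.card_le_one_of_second_neighbor (h : Decomposition G s t α) (ht : 30 ≤ t)
    (hl : ∀ v, α v < 4 ∨ (t - 1) / 2 < α v) {y z : V} (hyz : ¬ G.Adj y z)
    (hne : y ≠ z) (hy : (t - 1) / 2 < α y) (hd : α y + 1 ≤ α z)
    (hmin : ∀ p, (t - 1) / 2 < α p → p ≠ y → ¬ G.Adj y p → α y ≤ α p) {u : V}
    (huz : ¬ G.Adj z u) (hzu : z ≠ u) (huy : ¬ G.Adj y u) (hyu : y ≠ u) :
    #((Nb z \ Nb y) ∩ Nb u) ≤ 1 := by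
  by_contra hcon
  obtain ⟨a, ha, b, hb, hab⟩ := one_lt_card.1 (not_le.1 hcon)
  simp only [mem_inter, mem_sdiff, SimpleGraph.mem_neighborFinset] at ha hb
  have key := fun {p : V} (hzp : G.Adj z p) (hyp : ¬ G.Adj y p) =>
    (h.high_of_minimal ht hl hyz hne hy hd hmin hzp hyp).2.2
  have hu := h.sub_le_of_not_adj ht hyu.symm (fun h' => huy h'.symm) hy
  have hz := h.sub_le_of_not_adj ht hne.symm (fun h' => hyz h'.symm) hy
  have hcard : α y * (α z - α y) + (α z - α u) * (α z - α y) ≤ #((Nb z \ Nb y) \ Nb u) := by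
    have e1 := card_sdiff_real (Nb z \ Nb y) (Nb u)
    have e2 := h.card_sdiff_not_adj hne.symm (fun h' => hyz h'.symm)
    have e3 := card_sdiff_real (Nb z ∩ Nb u) (Nb y)
    have r3 : (Nb z \ Nb y) ∩ Nb u = (Nb z ∩ Nb u) \ Nb y := by grind
    have e4 := h.card_inter_not_adj hzu huz
    have e5 := h.card_inter_not_adj hyu huy
    have e6 := card_sdiff_real (Nb y ∩ Nb u) (Nb z)
    have r6 : (Nb z ∩ Nb u) ∩ Nb y = (Nb y ∩ Nb u) ∩ Nb z := by grind
    have e7 := h.card_sdiff_not_adj hne hyz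
    have e8 : #((Nb y ∩ Nb u) \ Nb z) ≤ #(Nb y \ Nb z) := card_le_card (by grind)
    have e8 : (#((Nb y ∩ Nb u) \ Nb z) : ℝ) ≤ #(Nb y \ Nb z) := by exact_mod_cast e8
    rw [r3] at e1
    rw [r6] at e3
    linarith
  have hP : ∀ q, G.Adj z q → ¬ G.Adj y q →
      #((Nb z ∩ Nb q) \ Nb y) ≤ 5 := fun q hzq hyq =>
    (h.high_of_minimal ht hl hyz hne hy hd hmin hzq hyq).2.1
  set P := (Nb z \ Nb y) \ Nb u with hPdef
  have hsplit : ∀ (S : Finset V) q, #S ≤ #(S \ Nb q) + #(S ∩ Nb q) := fun S q => by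
    rw [card_sdiff_add_card_inter]
  have hint : ∀ (S : Finset V) q, S ⊆ P → G.Adj z q → ¬ G.Adj y q →
      (#(S ∩ Nb q) : ℝ) ≤ 60 / 29 * (α z - α y) + 1 := fun S q hS hzq hyq => by
    refine le_trans ?_ (key hzq hyq)
    have : S ∩ Nb q ⊆ (Nb z ∩ Nb q) \ Nb y := by
      intro v hv
      have := hS (mem_inter.1 hv).1
      grind
    exact_mod_cast card_le_card this
  have i1 := hint P a subset_rfl ha.1.1 ha.1.2
  have i2 := hint (P \ Nb a) b sdiff_subset hb.1.1 hb.1.2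
  have s1 : (#P : ℝ) ≤ #(P \ Nb a) + #(P ∩ Nb a) := by exact_mod_cast hsplit P a
  have s2 : (#(P \ Nb a) : ℝ) ≤ #((P \ Nb a) \ Nb b) + #((P \ Nb a) ∩ Nb b) := by
    exact_mod_cast hsplit (P \ Nb a) b
  set Q := (P \ Nb a) \ Nb b with hQ
  have hQcard : (0 : ℝ) < #Q := by nlinarith
  obtain ⟨p, hp⟩ := card_pos.1 (by exact_mod_cast hQcard : 0 < #Q)
  have hp' := hp
  simp only [hQ, hPdef, mem_sdiff, SimpleGraph.mem_neighborFinset] at hp'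
  have i3 := hint Q p (sdiff_subset.trans sdiff_subset) hp'.1.1.1.1 hp'.1.1.1.2
  have s3 : (#Q : ℝ) ≤ #(Q \ Nb p) + #(Q ∩ Nb p) := by exact_mod_cast hsplit Q p
  have s4 : (#(Q \ Nb p) : ℝ) ≤ #((Q \ Nb p).erase p) + 1 := by
    have := pred_card_le_card_erase (s := Q \ Nb p) (a := p)
    have : #(Q \ Nb p) ≤ #((Q \ Nb p).erase p) + 1 := by omega
    exact_mod_cast this
  have hfin : (2 : ℝ) < #((Q \ Nb p).erase p) := by nlinarith
  obtain ⟨c, hc, d, hd', e, he, hcd, hce, hde⟩ := two_lt_card.1 (by exact_mod_cast hfin)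
  simp only [hQ, hPdef, mem_sdiff, mem_erase, SimpleGraph.mem_neighborFinset] at hc hd' he
  have hpu' : p ≠ u := by rintro rfl; exact huz hp'.1.1.1.1
  exact h.no_two_claws (by linarith) (z := z) (p := p) (u := u) (a := a) (b := b) (c := c) (d := d)
    (e := e) hp'.1.1.1.1 huz hzu (fun h' => hp'.1.1.2 h'.symm) hpu' ha.1.1 hb.1.1
    hc.2.1.1.1.1.1 hd'.2.1.1.1.1.1 he.2.1.1.1.1.1 ha.2 hb.2
    hc.2.1.1.1.2 hd'.2.1.1.1.2 he.2.1.1.1.2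
    (fun h' => hp'.1.2 h'.symm) (fun h' => hp'.2 h'.symm) hc.2.2 hd'.2.2 he.2.2
    hc.1.symm hd'.1.symm he.1.symm hc.2.1.1.2 hd'.2.1.1.2 he.2.1.1.2
    hc.2.1.2 hd'.2.1.2 he.2.1.2 hab hcd hce hde

theorem Decomposition.not_minimal (h : Decomposition G s t α) (ht : 30 ≤ t)
    (hl : ∀ v, α v < 4 ∨ (t - 1) / 2 < α v) {y z : V} (hyz : ¬ G.Adj y z)
    (hne : y ≠ z) (hy : (t - 1) / 2 < α y) (hd : α y + 1 ≤ α z)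
    (hmin : ∀ p, (t - 1) / 2 < α p → p ≠ y → ¬ G.Adj y p → α y ≤ α p) : False := by
  have hone := fun {u : V} => h.card_le_one_of_second_neighbor ht hl hyz hne hy hd hmin (u := u)
  have hsec := fun {p : V} => h.card_second_neighbors ht hl hyz hne hy hd hmin (p := p)
  have e2 := h.card_sdiff_not_adj hne.symm (fun h' => hyz h'.symm)
  have hP : (30 : ℝ) ≤ #(Nb z \ Nb y) := by nlinarith
  have hP : 30 ≤ #(Nb z \ Nb y) := by exact_mod_cast hP
  obtain ⟨p, hp⟩ := card_pos.1 (by omega : 0 < #(Nb z \ Nb y))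
  have hp' := hp
  simp only [mem_sdiff, SimpleGraph.mem_neighborFinset] at hp'
  have h5 := (h.high_of_minimal ht hl hyz hne hy hd hmin hp'.1 hp'.2).2.1
  have hs := card_sdiff_add_card_inter (Nb z \ Nb y) (Nb p)
  have hi : (Nb z \ Nb y) ∩ Nb p = (Nb z ∩ Nb p) \ Nb y := by grind
  rw [hi] at hs
  obtain ⟨q, hq⟩ := card_pos.1 (by
    have := pred_card_le_card_erase (s := (Nb z \ Nb y) \ Nb p) (a := p)
    omega : 0 < #(((Nb z \ Nb y) \ Nb p).erase p))
  simp only [mem_sdiff, mem_erase, SimpleGraph.mem_neighborFinset] at hq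
  obtain ⟨u, hu⟩ := card_pos.1 (lt_of_lt_of_le two_pos (hsec hp'.1 hp'.2))
  have hq2 := hsec hq.2.1.1 hq.2.1.2
  simp only [mem_sdiff, mem_erase, SimpleGraph.mem_neighborFinset] at hu
  have hnot : ∀ {p u}, G.Adj z p → ¬ G.Adj y p → G.Adj p u → y ≠ u := by
    rintro p u h1 h2 h3 rfl
    exact h2 h3.symm
  have huniq : ∀ {u p q}, u ≠ z → ¬ G.Adj y u → ¬ G.Adj z u → G.Adj z p → ¬ G.Adj y p →
      G.Adj z q → ¬ G.Adj y q → G.Adj p u → G.Adj q u → p = q := by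
    intro u p q h1 h2 h3 h4 h5 h6 h7 h8 h9
    refine Finset.card_le_one.1 (hone h3 h1.symm h2 (hnot h4 h5 h8)) p ?_ q ?_ <;>
      simp only [mem_inter, mem_sdiff, SimpleGraph.mem_neighborFinset]
    · exact ⟨⟨h4, h5⟩, h8.symm⟩
    · exact ⟨⟨h6, h7⟩, h9.symm⟩
  have hlow : ∀ {u p}, u ≠ z → ¬ G.Adj y u → ¬ G.Adj z u → G.Adj z p → ¬ G.Adj y p →
      G.Adj p u → α u ≤ 1 := by
    intro u p h1 h2 h3 h4 h5 h6
    have hyu := hnot h4 h5 h6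
    have h7 := hone h3 h1.symm h2 hyu
    have h7 : (#((Nb z \ Nb y) ∩ Nb u) : ℝ) ≤ 1 := by exact_mod_cast h7
    have r3 : (Nb z \ Nb y) ∩ Nb u = (Nb z ∩ Nb u) \ Nb y := by grind
    have r6 : (Nb z ∩ Nb u) ∩ Nb y = (Nb y ∩ Nb u) ∩ Nb z := by grind
    have e3 := card_sdiff_real (Nb z ∩ Nb u) (Nb y)
    have e4 := h.card_inter_not_adj h1.symm h3
    have e5 := h.card_inter_not_adj hyu h2
    have e6 := card_sdiff_real (Nb y ∩ Nb u) (Nb z)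
    have e8 : (0 : ℝ) ≤ #((Nb y ∩ Nb u) \ Nb z) := by positivity
    rw [r3] at h7
    rw [r6] at e3
    nlinarith [h.pos u]
  have hqu : ¬ G.Adj q u := fun h' => hq.1
    (huniq hu.1 hu.2.1.2 hu.2.2 hq.2.1.1 hq.2.1.2 hp'.1 hp'.2 h' hu.2.1.1)
  have hqu' : q ≠ u := by rintro rfl; exact hu.2.2 hq.2.1.1
  have hbad := h.card_le_one (by linarith) hu.2.1.1 hq.1 hqu' hq.2.2 (fun h' => hqu h'.symm)
  have hsub : ((Nb q \ Nb y) \ Nb z).erase z ⊆ (Nb q \ Nb p) \ Nb u := by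
    intro v hv
    simp only [mem_sdiff, mem_erase, SimpleGraph.mem_neighborFinset] at hv ⊢
    refine ⟨⟨hv.2.1.1, fun h' => hq.1 ?_⟩, fun h' => ?_⟩
    · exact huniq hv.1 hv.2.1.2 hv.2.2 hq.2.1.1 hq.2.1.2 hp'.1 hp'.2 hv.2.1.1 h'
    · have l1 := hlow hu.1 hu.2.1.2 hu.2.2 hp'.1 hp'.2 hu.2.1.1
      have l2 := hlow hv.1 hv.2.1.2 hv.2.2 hq.2.1.1 hq.2.1.2 hv.2.1.1
      have := h.le_mul_of_adj h'
      nlinarith [h.pos u, h.pos v]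
  have := card_le_card hsub
  omega

theorem Decomposition.eq_of_not_adj (h : Decomposition G s t α) (ht : 30 ≤ t)
    (hsep : ∀ x y, α x < α y → α x + 1 ≤ α y)
    (hl : ∀ v, α v < 4 ∨ (t - 1) / 2 < α v) {y z : V} (hy : (t - 1) / 2 < α y)
    (hz : (t - 1) / 2 < α z) (hne : y ≠ z) (hyz : ¬ G.Adj y z) : α y = α z := by
  by_contra hcon
  let S : Finset V := {y | (t - 1) / 2 < α y ∧ ∃ z, y ≠ z ∧ ¬ G.Adj y z ∧ α y < α z}
  have hS : S.Nonempty := by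
    rcases lt_or_gt_of_ne hcon with hlt | hlt
    · exact ⟨y, by simp only [S, mem_filter_univ]; exact ⟨hy, z, hne, hyz, hlt⟩⟩
    · exact ⟨z, by
        simp only [S, mem_filter_univ]
        exact ⟨hz, y, hne.symm, fun h' => hyz h'.symm, hlt⟩⟩
  obtain ⟨y', hy', hmin⟩ := S.exists_min_image α hS
  simp only [S, mem_filter_univ] at hy' hmin
  obtain ⟨hy1, z', hne', hyz', hlt'⟩ := hy'
  refine h.not_minimal ht hl hyz' hne' hy1 (hsep _ _ hlt') fun p hp hpy hyp => ?_
  by_contra hlt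
  push Not at hlt
  exact absurd (hmin p ⟨hp, y', hpy, fun h' => hyp h'.symm, hlt⟩) (not_le.2 hlt)

theorem Decomposition.sum_neighbors (h : Decomposition G s t α) (x : V) :
    ∑ v ∈ Nb x, α v = s * α x := by
  have := congrFun h.eig x
  rwa [SimpleGraph.adjMatrix_mulVec_apply] at this

theorem Decomposition.high_of_adj_low (h : Decomposition G s t α) (ht : 30 ≤ t)
    (hl : ∀ v, α v < 4 ∨ (t - 1) / 2 < α v) {w y : V} (hw : α w < 4) (hwy : G.Adj w y) :
    (t - 1) / 2 < α y := by
  have := h.le_mul_of_adj hwy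
  rcases hl y with hy | hy
  · nlinarith [h.pos w, h.pos y]
  · exact hy

theorem Decomposition.low_le_low (h : Decomposition G s t α) (ht : 30 ≤ t)
    (hsep : ∀ x y, α x < α y → α x + 1 ≤ α y)
    (hl : ∀ v, α v < 4 ∨ (t - 1) / 2 < α v) {u w : V} (hu : α u < 4) (hw : α w < 4) :
    α u ≤ α w := by
  by_contra! hlt
  have hne : w ≠ u := by rintro rfl; exact lt_irrefl _ hlt
  have hwu : ¬ G.Adj w u := fun h' => by
    have := h.high_of_adj_low ht hl hw h'
    linarith
  have hc := h.card_sdiff_not_adj hne hwu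
  have hle := h.le_of_not_adj hne hwu
  obtain ⟨y, hy⟩ : (Nb w \ Nb u).Nonempty := by
    rw [← card_pos, ← Nat.cast_pos (α := ℝ), hc]
    nlinarith [h.pos w]
  simp only [mem_sdiff, SimpleGraph.mem_neighborFinset] at hy
  have hyu : u ≠ y := by rintro rfl; exact hwu hy.1
  have hcom := h.card_common hy.1 hne.symm hyu hwu (fun h' => hy.2 h'.symm)
  have h0 : (0 : ℝ) ≤ #((Nb w ∩ Nb y) \ Nb u) := by positivity
  have h1 := hsep _ _ hlt
  have h2 := h.high_of_adj_low ht hl hw hy.1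
  nlinarith

theorem Decomposition.high_bound (h : Decomposition G s t α) (ht : 30 ≤ t)
    (hsep : ∀ x y, α x < α y → α x + 1 ≤ α y)
    (hl : ∀ v, α v < 4 ∨ (t - 1) / 2 < α v) (hcone : ∀ x, ∃ z, z ≠ x ∧ ¬ G.Adj x z)
    {w x : V} (hw : α w < 4) (hx : (t - 1) / 2 < α x) : α w * (α x - α w) ≤ t := by
  by_contra! hlt
  have hlow : ∀ v, α v < 4 → α v = α w := fun v hv =>
    le_antisymm (h.low_le_low ht hsep hl hv hw) (h.low_le_low ht hsep hl hw hv)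
  have hadj : ∀ v y, α v < 4 → α y = α x → G.Adj v y := fun v y hv hy => by
    by_contra hvy
    have := h.le_of_not_adj (x := v) (y := y) (by rintro rfl; linarith) hvy
    rw [hlow v hv, hy] at this
    linarith
  obtain ⟨z, hzx, hz⟩ := hcone x
  refine h.not_forall_not_adj ht (hadj w x hw rfl).symm (by linarith) hzx hz fun v hvx hv => ?_
  have hv' : (t - 1) / 2 < α v := (hl v).resolve_left fun h4 => hv (hadj v x h4 rfl).symm
  have heq := h.eq_of_not_adj ht hsep hl hv' hx hvx (fun h' => hv h'.symm)
  exact ⟨(hadj w v hw heq).symm, heq⟩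

theorem Decomposition.neighbors_of_low (h : Decomposition G s t α) (ht : 30 ≤ t)
    (hsep : ∀ x y, α x < α y → α x + 1 ≤ α y)
    (hl : ∀ v, α v < 4 ∨ (t - 1) / 2 < α v) (hcone : ∀ x, ∃ z, z ≠ x ∧ ¬ G.Adj x z)
    {w y z : V} (hw : α w < 4) (hy : G.Adj w y) (hz : G.Adj w z) : α y = α z := by
  by_contra hne
  have hy' := h.high_of_adj_low ht hl hw hy
  have hz' := h.high_of_adj_low ht hl hw hz
  have hval : ∀ x v, G.Adj w x → v ∈ Nb w \ Nb x → α v = α x := fun x v hx hv => by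
    simp only [mem_sdiff, SimpleGraph.mem_neighborFinset] at hv
    by_cases hvx : v = x
    · rw [hvx]
    · exact h.eq_of_not_adj ht hsep hl (h.high_of_adj_low ht hl hw hv.1)
        (h.high_of_adj_low ht hl hw hx) hvx (fun h' => hv.2 h'.symm)
  have hdis : Disjoint (Nb w \ Nb y) (Nb w \ Nb z) := by
    rw [disjoint_left]
    intro v hvy hvz
    exact hne ((hval y v hy hvy).symm.trans (hval z v hz hvz))
  have hsub : (Nb w \ Nb y) ∪ (Nb w \ Nb z) ⊆ Nb w := union_subset sdiff_subset sdiff_subset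
  have hcard := card_le_card hsub
  rw [card_union_of_disjoint hdis] at hcard
  have hcard' : (#(Nb w \ Nb y) : ℝ) + #(Nb w \ Nb z) ≤ #(Nb w) := by exact_mod_cast hcard
  rw [h.card_sdiff_adj hy, h.card_sdiff_adj hz, h.degree] at hcard'
  have b1 := h.high_bound ht hsep hl hcone hw hy'
  have b2 := h.high_bound ht hsep hl hcone hw hz'
  nlinarith [h.pos w]

theorem Decomposition.false_of_gap (h : Decomposition G s t α) (ht : 30 ≤ t)
    (hsep : ∀ x y, α x < α y → α x + 1 ≤ α y)
    (hl : ∀ v, α v < 4 ∨ (t - 1) / 2 < α v) (hcone : ∀ x, ∃ z, z ≠ x ∧ ¬ G.Adj x z)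
    (hreg : ∃ x y, α y < α x) (hbireg : ∀ a b, ∃ z, α z ≠ a ∧ α z ≠ b) : False := by
  by_cases hlow : ∃ w, α w < 4
  swap
  · push Not at hlow
    have hhigh : ∀ v, (t - 1) / 2 < α v := fun v => (hl v).resolve_left (not_lt.2 (hlow v))
    have heq : ∀ {x y}, x ≠ y → ¬ G.Adj x y → α x = α y := fun hne hxy =>
      h.eq_of_not_adj ht hsep hl (hhigh _) (hhigh _) hne hxy
    have hadj : ∀ {x y}, α y < α x → G.Adj x y := fun {x y} hlt => by
      by_contra hxy
      exact hlt.ne' (heq (by rintro rfl; exact lt_irrefl _ hlt) hxy)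
    obtain ⟨x, y, hlt⟩ := hreg
    obtain ⟨z, hzx, hz⟩ := hcone x
    refine h.not_forall_not_adj ht (hadj hlt) hlt hzx hz fun v hvx hv => ?_
    have hvx' := heq hvx (fun h' => hv h'.symm)
    exact ⟨hadj (by rwa [hvx']), hvx'⟩
  obtain ⟨w, hw⟩ := hlow
  have hlow : ∀ v, α v < 4 → α v = α w := fun v hv =>
    le_antisymm (h.low_le_low ht hsep hl hv hw) (h.low_le_low ht hsep hl hw hv)
  have hpos := h.pos w
  obtain ⟨y, hy⟩ : (Nb w).Nonempty := by
    rw [← card_pos, ← Nat.cast_pos (α := ℝ), h.degree]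
    positivity
  rw [SimpleGraph.mem_neighborFinset] at hy
  have hy' := h.high_of_adj_low ht hl hw hy
  have mono := fun {w y z : V} => h.neighbors_of_low ht hsep hl hcone (w := w) (y := y) (z := z)
  -- a high vertex missing the common value on the neighbourhood of a low vertex
  have hval : ∀ {v x z}, α v < 4 → G.Adj v x → (t - 1) / 2 < α z → α z ≠ α x → ¬ G.Adj v z →
      t + α w * (α w - α z) = 0 := by
    intro v x z hv hvx hz hzx hvz
    have hvz' : v ≠ z := by rintro rfl; linarith
    have hemp : Nb v \ Nb z = ∅ := by
      rw [eq_empty_iff_forall_notMem]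
      intro u hu
      simp only [mem_sdiff, SimpleGraph.mem_neighborFinset] at hu
      have hux := mono hv hu.1 hvx
      refine hzx ((h.eq_of_not_adj ht hsep hl hz (h.high_of_adj_low ht hl hv hu.1) ?_ hu.2).trans
        hux)
      rintro rfl
      exact hvz hu.1
    have := h.card_sdiff_not_adj hvz' hvz
    rw [hemp, card_empty, hlow v hv] at this
    simpa using this.symm
  have hmiss : ∀ z, α z ≠ α w → α z ≠ α y → (t - 1) / 2 < α z ∧
      t + α w * (α w - α z) = 0 := by
    intro z hzw hzy
    have hz : (t - 1) / 2 < α z := (hl z).resolve_left fun h4 => hzw (hlow z h4)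
    exact ⟨hz, hval hw hy hz hzy fun h' => hzy (mono hw h' hy)⟩
  obtain ⟨z, hzw, hzy⟩ := hbireg (α w) (α y)
  obtain ⟨hz, hzt⟩ := hmiss z hzw hzy
  have hyz : α y ≤ α z := by
    have := h.high_bound ht hsep hl hcone hw hy'
    nlinarith
  have hzlow : ∀ v, α v < 4 → ¬ G.Adj v z := by
    intro v hv hvz
    have := hval hv hvz hy' hzy.symm fun h' => hzy (mono hv hvz h')
    exact hzy (mul_left_cancel₀ hpos.ne' (by linarith))
  have hge : ∀ v ∈ Nb z, α y ≤ α v := by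
    intro v hv
    rw [SimpleGraph.mem_neighborFinset] at hv
    by_cases hvy : α v = α y
    · exact hvy.ge
    have hvw : α v ≠ α w := fun h' => hzlow v (by linarith) hv.symm
    have := (hmiss v hvw hvy).2
    have : α v = α z := mul_left_cancel₀ hpos.ne' (by linarith)
    rwa [this]
  have s1 := card_nsmul_le_sum _ _ _ hge
  rw [h.sum_neighbors, nsmul_eq_mul, h.degree] at s1
  have s2 : ∑ v ∈ Nb w, α v = ∑ v ∈ Nb w, α y := sum_congr rfl fun v hv =>
    mono hw (by simpa using hv) hy
  rw [h.sum_neighbors, sum_const, nsmul_eq_mul, h.degree] at s2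
  have s3 : s = α z * α y := mul_left_cancel₀ hpos.ne' (by
    linear_combination s2 + α y * hzt)
  rw [s3] at s1
  nlinarith [mul_pos (show 0 < t by linarith) (h.pos y)]

theorem exists_rank_factorization (M : Matrix V V ℝ) :
    ∃ (B : Matrix V (Fin M.rank) ℝ) (C : Matrix (Fin M.rank) V ℝ), M = B * C := by
  let b : Module.Basis (Fin M.rank) ℝ (LinearMap.range M.mulVecLin) := Module.finBasis ℝ _
  refine ⟨Matrix.of fun x i => (b i : V → ℝ) x, Matrix.of fun i y =>
    b.repr ⟨M.mulVecLin (Pi.single y 1), LinearMap.mem_range_self _ _⟩ i, ?_⟩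
  ext x y
  have := b.sum_repr ⟨M.mulVecLin (Pi.single y 1), LinearMap.mem_range_self _ _⟩
  have := congrArg (fun v : LinearMap.range M.mulVecLin => (v : V → ℝ) x) this
  simp only [Submodule.coe_sum, Submodule.coe_smul, Finset.sum_apply, Pi.smul_apply, smul_eq_mul,
    mulVecLin_apply, mulVec_single_one, col_apply] at this
  rw [Matrix.mul_apply, ← this]
  exact sum_congr rfl fun i _ => by simp [mul_comm]

theorem trace_eq_rank_of_isIdempotentElem {M : Matrix V V ℝ} (hM : M * M = M) :
    M.trace = M.rank := by
  have hi : IsIdempotentElem (Matrix.toLin' M) := by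
    rw [IsIdempotentElem, Module.End.mul_eq_comp, ← Matrix.toLin'_mul, hM]
  have := (LinearMap.IsIdempotentElem.isProj_range _ hi).trace
  rw [Matrix.trace_toLin'_eq] at this
  rw [this]
  rfl

theorem rank_sq_le {W : Type} [Fintype W] {k : ℕ} (B : Matrix W (Fin k) ℝ)
    (C : Matrix (Fin k) W ℝ) :
    (Matrix.of fun x y => (B * C) x y ^ 2).rank ≤ (k + 1).choose 2 := by
  let g : Sym2 (Fin k) → W → ℝ := fun p x => Sym2.lift ⟨fun i j => B x i * B x j, fun i j =>
    mul_comm _ _⟩ p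
  have hspan : Submodule.span ℝ (Set.range (Matrix.of fun x y => (B * C) x y ^ 2).col)
      ≤ Submodule.span ℝ (Set.range g) := by
    rw [Submodule.span_le]
    rintro _ ⟨y, rfl⟩
    have : (Matrix.of fun x y => (B * C) x y ^ 2).col y
        = ∑ i, ∑ j, (C i y * C j y) • g s(i, j) := by
      ext x
      simp only [col_apply, of_apply, Matrix.mul_apply, sq, Finset.sum_mul_sum, Finset.sum_apply,
        Pi.smul_apply, smul_eq_mul, g, Sym2.lift_mk]
      exact sum_congr rfl fun i _ => sum_congr rfl fun j _ => by ring
    rw [this]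
    exact Submodule.sum_mem _ fun i _ => Submodule.sum_mem _ fun j _ =>
      Submodule.smul_mem _ _ (Submodule.subset_span ⟨_, rfl⟩)
  rw [rank_eq_finrank_span_cols]
  refine (Submodule.finrank_mono hspan).trans ((finrank_range_le_card g).trans ?_)
  rw [Sym2.card, Fintype.card_fin]

theorem Decomposition.dotProduct_self [Nonempty V] (h : Decomposition G s t α) :
    α ⬝ᵥ α = (s - 1) * (s + t) := by
  obtain ⟨x⟩ := ‹Nonempty V›
  have := congrFun (congrArg (fun K => K *ᵥ α) h.key) x
  simp only [sub_mulVec, add_mulVec, smul_mulVec, ← mulVec_mulVec, h.eig, mulVec_smul,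
    one_mulVec, vecMulVec_mulVec] at this
  simp at this
  exact mul_left_cancel₀ (h.pos x).ne' (by linarith)

theorem Decomposition.exists_factorization [Nonempty V] (h : Decomposition G s t α) (hs : 1 < s)
    (ht : 30 ≤ t) : ∃ (r : ℕ) (B : Matrix V (Fin (r + 1)) ℝ) (C : Matrix (Fin (r + 1)) V ℝ),
      (t + 1) * r = Fintype.card V + s - 1 ∧ 1 - G.adjMatrix ℝ = B * C := by
  set A := G.adjMatrix ℝ with hA
  set J := vecMulVec α α with hJ
  have hAJ : A * J = s • J := by
    rw [hJ, mul_vecMulVec, h.eig, smul_vecMulVec]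
  have hJA : J * A = s • J := by
    have hAt : Aᵀ = A := G.transpose_adjMatrix
    rw [hJ, vecMulVec_mul, ← mulVec_transpose, hAt, h.eig, vecMulVec_smul]
  have hJJ : J * J = ((s - 1) * (s + t)) • J := by
    rw [hJ, vecMulVec_mul_vecMulVec, h.dotProduct_self, vecMulVec_smul]
  have hk : A * A = J - (t - 1) • A + t • (1 : Matrix V V ℝ) := by
    rw [hJ, ← h.key]; abel
  have hst : s + t ≠ 0 := by positivity
  have ht1 : t + 1 ≠ 0 := by positivity
  set X := 1 - A + (1 / (s + t)) • J with hX
  have hXX : X * X = (t + 1) • X := by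
    simp only [hX, add_mul, mul_add, sub_mul, mul_sub, one_mul, mul_one, smul_mul_assoc,
      mul_smul_comm, hk, hAJ, hJA, hJJ]
    match_scalars <;> field_simp <;> ring
  set E := (1 / (t + 1)) • X with hE
  have hEE : E * E = E := by
    rw [hE, smul_mul_assoc, mul_smul_comm, hXX, smul_smul, smul_smul]
    congr 1
    field_simp
  have htr := trace_eq_rank_of_isIdempotentElem hEE
  have htX : X.trace = Fintype.card V + s - 1 := by
    rw [hX, trace_add, trace_sub, trace_one, trace_smul, hJ, trace_vecMulVec, h.dotProduct_self, hA,
      SimpleGraph.trace_adjMatrix, smul_eq_mul]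
    field_simp; ring
  rw [hE, trace_smul, htX, smul_eq_mul] at htr
  obtain ⟨B, C, hBC⟩ := exists_rank_factorization E
  refine ⟨E.rank, Matrix.of fun x => Fin.snoc (fun i => (t + 1) * B x i) (-(1 / (s + t)) * α x),
    Matrix.of fun i y => Fin.snoc (α := fun _ => ℝ) (fun i => C i y) (α y) i, ?_, ?_⟩
  · rw [← htr]; field_simp
  · ext x y
    have e1 := congrFun (congrFun hBC x) y
    rw [Matrix.mul_apply] at e1 ⊢
    rw [Fin.sum_univ_castSucc]
    simp only [of_apply, Fin.snoc_castSucc, Fin.snoc_last, mul_assoc, ← Finset.mul_sum]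
    rw [← e1, hE, Matrix.smul_apply, hX, Matrix.add_apply, Matrix.smul_apply, hJ, vecMulVec_apply]
    simp only [smul_eq_mul]
    field_simp
    ring

theorem Decomposition.rank_one_add (h : Decomposition G s t α) (hs : 1 < s) (ht : 30 ≤ t) :
    (1 + G.adjMatrix ℝ).rank = Fintype.card V := by
  refine rank_of_isUnit _ (mulVec_injective_iff_isUnit.1 ?_)
  rw [← coe_mulVecLin, injective_iff_map_eq_zero]
  intro f hf
  rw [mulVecLin_apply, add_mulVec, one_mulVec] at hf
  have hAf : G.adjMatrix ℝ *ᵥ f = -f := eq_neg_of_add_eq_zero_right hf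
  have hdot : α ⬝ᵥ f = 0 := by
    have e : α ⬝ᵥ (G.adjMatrix ℝ *ᵥ f) = s * (α ⬝ᵥ f) := by
      rw [dotProduct_mulVec, ← mulVec_transpose, SimpleGraph.transpose_adjMatrix, h.eig,
        smul_dotProduct, smul_eq_mul]
    rw [hAf, dotProduct_neg] at e
    nlinarith
  have e := congrArg (fun K => K *ᵥ f) h.key
  simp only [sub_mulVec, add_mulVec, smul_mulVec, ← mulVec_mulVec, hAf, mulVec_neg,
    one_mulVec, vecMulVec_mulVec, hdot] at e
  ext x
  have := congrFun e x
  simp at this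
  simp
  nlinarith

theorem exists_indep_subset (T : Finset V) (hT : ∀ z ∈ T, #(Nb z ∩ T) ≤ 1) :
    ∃ S ⊆ T, (∀ x ∈ S, ∀ y ∈ S, ¬ G.Adj x y) ∧ #T ≤ 2 * #S := by
  let F := T.powerset.filter fun S => ∀ x ∈ S, ∀ y ∈ S, ¬ G.Adj x y
  obtain ⟨S, hS, hmax⟩ := F.exists_max_image card ⟨∅, by simp [F]⟩
  simp only [F, mem_filter, mem_powerset] at hS hmax
  refine ⟨S, hS.1, hS.2, ?_⟩
  have hcov : T \ S ⊆ S.biUnion fun z => Nb z ∩ T := by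
    intro v hv
    rw [mem_sdiff] at hv
    by_contra hcon
    simp only [mem_biUnion, mem_inter, SimpleGraph.mem_neighborFinset, not_exists, not_and]
      at hcon
    have hno : ∀ z ∈ S, ¬ G.Adj z v := fun z hz h' => hcon z hz h' hv.1
    have := hmax (insert v S) ⟨insert_subset hv.1 hS.1, by
      intro x hx y hy
      rcases mem_insert.1 hx with hx' | hx' <;> rcases mem_insert.1 hy with hy' | hy'
      · rw [hx', hy']; exact G.irrefl
      · rw [hx']; exact fun h' => hno y hy' h'.symm
      · rw [hy']; exact hno x hx'
      · exact hS.2 x hx' y hy'⟩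
    rw [card_insert_of_notMem hv.2] at this
    omega
  have h1 := (card_le_card hcov).trans (card_biUnion_le_card_mul _ _ 1 fun z hz => hT z (hS.1 hz))
  have h2 := card_sdiff_add_card_eq_card hS.1
  omega

theorem Decomposition.exists_large [Nonempty V] (h : Decomposition G s t α) (hs : 1 < s)
    (ht : 30 ≤ t) : ∃ x, (∀ v, α v ≤ α x) ∧ (t - 1) * (t - 2) - 4 * t ≤ 2 * α x ^ 2 := by
  obtain ⟨x, hx⟩ := Finite.exists_max α
  refine ⟨x, hx, ?_⟩
  obtain ⟨r, B, C, hr, hBC⟩ := h.exists_factorization hs ht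
  have hsq : (Matrix.of fun x y => (B * C) x y ^ 2) = 1 + G.adjMatrix ℝ := by
    rw [← hBC]
    ext x y
    simp only [of_apply, Matrix.sub_apply, Matrix.add_apply, Matrix.one_apply,
      SimpleGraph.adjMatrix_apply]
    by_cases hxy : x = y
    · subst hxy; simp
    · by_cases hadj : G.Adj x y <;> simp [hxy, hadj]
  have hn := rank_sq_le B C
  rw [hsq, h.rank_one_add hs ht] at hn
  have hn : (Fintype.card V : ℝ) ≤ (r + 2) * (r + 1) / 2 := by
    have : (Fintype.card V : ℝ) ≤ ((r + 1 + 1).choose 2 : ℕ) := by exact_mod_cast hn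
    rw [Nat.cast_choose_two] at this
    push_cast at this
    linarith
  have hdeg := h.degree x
  have hsx : s ≤ #(Nb x) := by
    have h1 := h.sum_neighbors x
    have h2 := sum_le_card_nsmul (Nb x) α (α x) fun v _ => hx v
    rw [h1, nsmul_eq_mul] at h2
    exact le_of_mul_le_mul_right h2 (h.pos x)
  have hdn : (#(Nb x) : ℝ) + 1 ≤ Fintype.card V := by
    have := G.degree_lt_card_verts x
    rw [← SimpleGraph.card_neighborFinset_eq_degree] at this
    exact_mod_cast this
  have hr0 : (0 : ℝ) < r := by nlinarith
  have hrt : t - 2 ≤ r := by nlinarith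
  obtain ⟨y, hy⟩ : (Nb x).Nonempty := by
    rw [← card_pos, ← Nat.cast_pos (α := ℝ), hdeg]
    positivity
  rw [SimpleGraph.mem_neighborFinset] at hy
  set T := (Nb x ∪ Nb y)ᶜ with hT
  obtain ⟨S, hST, hS, hcard⟩ := exists_indep_subset (G := G) T (by
    intro z hz
    simp only [hT, mem_compl, mem_union, SimpleGraph.mem_neighborFinset, not_or] at hz
    have := h.card_le_one (by linarith) hy (z := z) (by rintro rfl; exact hz.2 hy.symm)
      (by rintro rfl; exact hz.1 hy) hz.1 hz.2
    refine le_trans (card_le_card ?_) this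
    intro w hw
    simp only [hT, mem_inter, mem_compl, mem_union, mem_sdiff, not_or] at hw ⊢
    tauto)
  have hSr := card_le_of_isIndepSet hBC S hS
  have hT1 := card_compl_add_card (Nb x ∪ Nb y)
  have hT2 := card_union_add_card_inter (Nb x) (Nb y)
  have hTr : (#T : ℝ) ≤ 2 * (r + 1) := by
    have : #T ≤ 2 * (r + 1) := by omega
    exact_mod_cast this
  have hT1 : (#T : ℝ) + #(Nb x ∪ Nb y) = Fintype.card V := by exact_mod_cast hT1
  have hT2 : (#(Nb x ∪ Nb y) : ℝ) + #(Nb x ∩ Nb y) = #(Nb x) + #(Nb y) := by exact_mod_cast hT2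
  have hxy := h.card_inter_adj hy
  have hdy := h.degree y
  have hn2 : (Fintype.card V : ℝ) ≤ α x ^ 2 + 3 * t + 1 + 2 * r := by
    have : α y * (α y - α x) ≤ 0 := mul_nonpos_of_nonneg_of_nonpos (h.pos y).le
      (sub_nonpos.2 (hx y))
    linarith
  have hlow := mul_le_mul_of_nonneg_left hrt (show 0 ≤ t - 1 by linarith)
  linarith

theorem Decomposition.gap [Nonempty V] (h : Decomposition G s t α) (hs : 1 < s)
    (ht : 30 ≤ t) (v : V) : α v < 4 ∨ (t - 1) / 2 < α v := by
  obtain ⟨x, -, hx⟩ := h.exists_large hs ht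
  have hD : (t + 7) / 2 < α x := by
    by_contra! hle
    nlinarith [h.pos x]
  by_cases hvx : v = x
  · right; rw [hvx]; linarith
  have hle : α v * (α x - α v) ≤ 2 * t - 2 := by
    by_cases hadj : G.Adj v x
    · exact h.le_of_adj hadj
    · linarith [h.le_of_not_adj hvx hadj]
  by_contra! hcon
  nlinarith [h.pos v, mul_nonneg (sub_nonneg.2 hcon.1) (sub_nonneg.2 hcon.2)]

theorem eq_zero_of_nonneg {W : Type} [Fintype W] {H : SimpleGraph W} [DecidableRel H.Adj]
    (hconn : H.Connected) {v : W → ℝ} (hv : H.adjMatrix ℝ *ᵥ v = s • v) (hv0 : ∀ x, 0 ≤ v x)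
    {x : W} (hx : v x = 0) : v = 0 := by
  ext y
  obtain ⟨p⟩ := hconn.preconnected x y
  induction p with
  | nil => exact hx
  | @cons x u y hadj p ih =>
    refine ih ?_
    have h1 := congrFun hv x
    rw [SimpleGraph.adjMatrix_mulVec_apply, Pi.smul_apply, hx, smul_zero,
      sum_eq_zero_iff_of_nonneg fun i _ => hv0 i] at h1
    exact h1 u (by simpa using hadj)

theorem mulVec_abs (hpsd : (s • (1 : Matrix V V ℝ) - G.adjMatrix ℝ).PosSemidef) {v : V → ℝ}
    (hv : G.adjMatrix ℝ *ᵥ v = s • v) : G.adjMatrix ℝ *ᵥ |v| = s • |v| := by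
  have h0 : star |v| ⬝ᵥ ((s • (1 : Matrix V V ℝ) - G.adjMatrix ℝ) *ᵥ |v|) = 0 := by
    refine le_antisymm ?_ (hpsd.dotProduct_mulVec_nonneg _)
    have h1 : v ⬝ᵥ (G.adjMatrix ℝ *ᵥ v) ≤ |v| ⬝ᵥ (G.adjMatrix ℝ *ᵥ |v|) := by
      simp only [dotProduct, SimpleGraph.adjMatrix_mulVec_apply, Finset.mul_sum]
      refine sum_le_sum fun i _ => sum_le_sum fun j _ => ?_
      rw [Pi.abs_apply, Pi.abs_apply, ← abs_mul]
      exact le_abs_self _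
    have h2 : |v| ⬝ᵥ |v| = v ⬝ᵥ v := by simp [dotProduct]
    rw [hv, dotProduct_smul] at h1
    rw [star_trivial, sub_mulVec, smul_mulVec, one_mulVec, dotProduct_sub, dotProduct_smul, h2]
    linarith
  have h1 := (hpsd.dotProduct_mulVec_zero_iff _).1 h0
  rw [sub_mulVec, smul_mulVec, one_mulVec, sub_eq_zero] at h1
  exact h1.symm

theorem eq_zero_of_apply_eq_zero (hconn : G.Connected)
    (hpsd : (s • (1 : Matrix V V ℝ) - G.adjMatrix ℝ).PosSemidef) {v : V → ℝ}
    (hv : G.adjMatrix ℝ *ᵥ v = s • v) {x : V} (hx : v x = 0) : v = 0 := by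
  have := eq_zero_of_nonneg hconn (mulVec_abs hpsd hv) (fun y => abs_nonneg (v y))
    (x := x) (by simp [hx])
  ext y
  exact abs_eq_zero.1 (congrFun this y)

open scoped Pointwise in
theorem posSemidef_of_spectrum {A : Matrix V V ℝ} (hA : A.IsHermitian)
    (hspec : ∀ a ∈ spectrum ℝ A, a ≤ s) : (s • (1 : Matrix V V ℝ) - A).PosSemidef := by
  have hH : (s • (1 : Matrix V V ℝ) - A).IsHermitian := by
    refine IsHermitian.sub ?_ hA
    simp [IsHermitian]
  rw [hH.posSemidef_iff_eigenvalues_nonneg]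
  intro i
  have hsp : spectrum ℝ (s • (1 : Matrix V V ℝ) - A) = {s} - spectrum ℝ A := by
    rw [← Algebra.algebraMap_eq_smul_one, ← spectrum.singleton_sub_eq]
  obtain ⟨a, ha, b, hb, hab⟩ := Set.mem_sub.1 (hsp ▸ hH.eigenvalues_mem_spectrum_real i)
  rw [Set.mem_singleton_iff] at ha
  have := hspec b hb
  rw [Pi.zero_apply, ← hab]
  linarith

theorem mul_eq_zero_of_spectrum {A : Matrix V V ℝ} (hA : A.IsHermitian)
    (hspec : spectrum ℝ A = {s, 1, -t}) :
    (A - s • (1 : Matrix V V ℝ)) * (A * A + (t - 1) • A - t • (1 : Matrix V V ℝ)) = 0 := by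
  apply (toEuclideanLin (𝕜 := ℝ)).injective
  rw [map_zero]
  refine hA.eigenvectorBasis.toBasis.ext fun i => ?_
  have he := hA.mulVec_eigenvectorBasis i
  have hi := hA.eigenvalues_mem_spectrum_real i
  rw [hspec] at hi
  rw [OrthonormalBasis.coe_toBasis]
  ext x
  simp only [toLpLin_apply, ← mulVec_mulVec, sub_mulVec, add_mulVec, smul_mulVec, he, one_mulVec,
    mulVec_smul, mulVec_sub, mulVec_add]
  simp only [LinearMap.zero_apply, PiLp.zero_apply,
    Pi.smul_apply, Pi.sub_apply, Pi.add_apply, smul_eq_mul]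
  rcases hi with hi | hi | hi <;> rw [hi] <;> ring

theorem exists_eigenvector {A : Matrix V V ℝ} (hA : A.IsHermitian) (hs : s ∈ spectrum ℝ A) :
    ∃ v : V → ℝ, v ≠ 0 ∧ A *ᵥ v = s • v := by
  rw [hA.spectrum_real_eq_range_eigenvalues] at hs
  obtain ⟨i, rfl⟩ := hs
  refine ⟨_, ?_, hA.mulVec_eigenvectorBasis i⟩
  intro h0
  exact hA.eigenvectorBasis.orthonormal.ne_zero i (by ext x; exact congrFun h0 x)

theorem exists_decomposition (hconn : G.Connected) (hs : 1 < s) (ht : -t < 1)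
    (hspec : spectrum ℝ (G.adjMatrix ℝ) = {s, 1, -t}) : ∃ α, Decomposition G s t α := by
  have hA : (G.adjMatrix ℝ).IsHermitian := by
    rw [IsHermitian, conjTranspose_eq_transpose_of_trivial, SimpleGraph.transpose_adjMatrix]
  have hpsd : (s • (1 : Matrix V V ℝ) - G.adjMatrix ℝ).PosSemidef := by
    refine posSemidef_of_spectrum hA fun a ha => ?_
    rw [hspec] at ha
    rcases ha with rfl | rfl | rfl <;> linarith
  obtain ⟨v, hv0, hv⟩ := exists_eigenvector hA (s := s) (by simp [hspec])
  have hw := mulVec_abs hpsd hv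
  set w := |v| with hwdef
  have hpos : ∀ x, 0 < w x := fun x => by
    refine (abs_nonneg (v x)).lt_of_ne fun hx => hv0 ?_
    exact eq_zero_of_apply_eq_zero hconn hpsd hv (abs_eq_zero.1 hx.symm)
  set K := G.adjMatrix ℝ * G.adjMatrix ℝ + (t - 1) • G.adjMatrix ℝ - t • (1 : Matrix V V ℝ)
    with hK
  have hAK : G.adjMatrix ℝ * K = s • K := by
    have := mul_eq_zero_of_spectrum hA hspec
    rwa [sub_mul, smul_mul_assoc, one_mul, sub_eq_zero] at this
  have hKt : Kᵀ = K := by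
    simp only [hK, transpose_sub, transpose_add, transpose_mul, transpose_smul, transpose_one,
      SimpleGraph.transpose_adjMatrix]
  have hprop : ∀ x y z, K x y * w z = K z y * w x := fun x y z => by
    have hcol : G.adjMatrix ℝ *ᵥ K.col y = s • K.col y := by
      ext u
      exact congrFun (congrFun hAK u) y
    have := eq_zero_of_apply_eq_zero hconn hpsd (v := w x • K.col y - K x y • w) (x := x)
      (by rw [mulVec_sub, mulVec_smul, mulVec_smul, hcol, hw, smul_sub, smul_comm s, smul_comm s])
      (by simp [mul_comm])
    have := congrFun this z
    simp only [Pi.sub_apply, Pi.smul_apply, col_apply, smul_eq_mul, Pi.zero_apply] at this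
    linarith
  have hsymm : ∀ x y, K x y = K y x := fun x y => congrFun (congrFun hKt y) x
  obtain ⟨x₀⟩ := hconn.nonempty
  set c := K x₀ x₀ / w x₀ ^ 2 with hc
  have hKc : ∀ x y, K x y = c * (w x * w y) := fun x y => by
    have h1 := hprop x y x₀
    have h2 := hprop y x₀ x₀
    rw [hsymm y x₀] at h2
    rw [hc, div_mul_eq_mul_div, eq_div_iff (pow_pos (hpos x₀) 2).ne']
    linear_combination w x₀ * h1 + w x * h2
  have hKw : K *ᵥ w = ((s - 1) * (s + t)) • w := by
    simp only [hK, sub_mulVec, add_mulVec, smul_mulVec, ← mulVec_mulVec, hw, mulVec_smul,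
      one_mulVec]
    module
  have hcpos : 0 < c := by
    have h1 := congrFun hKw x₀
    have h2 : (K *ᵥ w) x₀ = c * w x₀ * (w ⬝ᵥ w) := by
      simp only [mulVec, dotProduct, hKc, Finset.mul_sum]
      exact sum_congr rfl fun _ _ => by ring
    rw [h2, Pi.smul_apply, smul_eq_mul] at h1
    have h3 : 0 < w ⬝ᵥ w := sum_pos (fun i _ => mul_pos (hpos i) (hpos i)) ⟨x₀, mem_univ _⟩
    have h4 : 0 < c * (w x₀ * (w ⬝ᵥ w)) := by
      rw [← mul_assoc, h1]
      exact mul_pos (mul_pos (by linarith) (by linarith)) (hpos x₀)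
    exact (pos_iff_pos_of_mul_pos h4).2 (mul_pos (hpos x₀) h3)
  refine ⟨√c • w, fun x => mul_pos (Real.sqrt_pos.2 hcpos) (hpos x), ?_, ?_⟩
  · ext x y
    rw [← hK, hKc, vecMulVec_apply, Pi.smul_apply, Pi.smul_apply, smul_eq_mul, smul_eq_mul]
    linear_combination -(w x * w y) * Real.mul_self_sqrt hcpos.le
  · rw [mulVec_smul, hw, smul_comm]

theorem exists_int_of_quadratic {u : ℝ} {a b c d : ℤ} (h : u ^ 2 + a * u + b = 0) (hc : c ≠ 0)
    (hu : u * c = d) : ∃ k : ℤ, u = k := by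
  have hc' : (c : ℝ) ≠ 0 := by exact_mod_cast hc
  have hq : u = ((d / c : ℚ) : ℝ) := by
    push_cast
    rw [eq_div_iff hc', hu]
  rw [hq] at h
  have hint : IsIntegral ℤ (d / c : ℚ) := by
    refine ⟨Polynomial.X ^ 2 + (Polynomial.C a * Polynomial.X + Polynomial.C b),
      Polynomial.monic_X_pow_add (Polynomial.degree_linear_lt), ?_⟩
    have h' : (d / c : ℚ) ^ 2 + a * (d / c : ℚ) + b = 0 := by exact_mod_cast h
    simp only [Polynomial.eval₂_add, Polynomial.eval₂_mul, Polynomial.eval₂_X_pow,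
      Polynomial.eval₂_X, Polynomial.eval₂_C]
    rw [← add_assoc]
    simpa using h'
  obtain ⟨k, hk⟩ := IsIntegrallyClosed.isIntegral_iff.1 hint
  refine ⟨k, ?_⟩
  rw [hq, ← hk]
  simp

theorem Decomposition.exists_int (h : Decomposition G s t α) {x z : V} (hne : x ≠ z)
    (hxz : ¬ G.Adj x z) : ∃ k : ℤ, t = k := by
  have hμ := h.card_inter_not_adj hne hxz
  have hμ0 : 0 < #(Nb x ∩ Nb z) := by
    rw [← Nat.cast_pos (α := ℝ), hμ]
    exact mul_pos (h.pos x) (h.pos z)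
  obtain ⟨y, hy⟩ := card_pos.1 hμ0
  simp only [mem_inter, SimpleGraph.mem_neighborFinset] at hy
  have hl := h.card_inter_adj hy.1
  have hl' := h.card_inter_adj hy.2
  have hx := h.degree x
  have hy' := h.degree y
  have hz := h.degree z
  have hx0 : 0 < #(Nb x) := card_pos.2 ⟨y, by simpa using hy.1⟩
  have hz0 : 0 < #(Nb z) := card_pos.2 ⟨y, by simpa using hy.2⟩
  generalize #(Nb x ∩ Nb z) = μ at *
  generalize #(Nb x ∩ Nb y) = l at *
  generalize #(Nb z ∩ Nb y) = l' at *
  generalize #(Nb x) = dx at *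
  generalize #(Nb y) = dy at *
  generalize #(Nb z) = dz at *
  have e1 : ((dx : ℝ) - t) * (dz - t) = μ ^ 2 := by rw [hx, hz, hμ]; ring
  have e2 : ((l : ℝ) + t - 1) * (l' + t - 1) = (dy - t) * μ := by rw [hl, hl', hy', hμ]; ring
  refine exists_int_of_quadratic (a := -(dx + dz)) (b := dx * dz - μ ^ 2)
    (c := l + l' - 2 + μ + dx + dz) (d := dx * dz - μ ^ 2 - ((l - 1) * (l' - 1) - dy * μ))
    ?_ (by omega) ?_
  · push_cast; linear_combination e1
  · push_cast; linear_combination e2 - e1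

theorem Decomposition.add_one_le (h : Decomposition G s t α) {k : ℤ} (ht : t = k) {x y : V}
    (hxy : α x < α y) : α x + 1 ≤ α y := by
  have hprod : ∀ u v, ∃ m : ℤ, α u * α v = m := fun u v => by
    refine ⟨#(Nb u ∩ Nb v) + (k - 1) * (if G.Adj u v then 1 else 0)
      - k * (if u = v then 1 else 0), ?_⟩
    rw [← h.card_inter u v, ht]
    push_cast
    rfl
  obtain ⟨a, ha⟩ := hprod x x
  obtain ⟨b, hb⟩ := hprod x y
  obtain ⟨c, hc⟩ := hprod y y
  have e : (α y - α x) ^ 2 = ((a - 2 * b + c : ℤ) : ℝ) := by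
    push_cast; rw [← ha, ← hb, ← hc]; ring
  have hpos : 0 < (α y - α x) ^ 2 := pow_pos (sub_pos.2 hxy) 2
  rw [e, Int.cast_pos] at hpos
  have : (1 : ℝ) ≤ (α y - α x) ^ 2 := by rw [e]; exact_mod_cast hpos
  nlinarith

end ThreeEigenvalues

/-- Every graph in H′(s,t) (connected, nonregular, spectrum {s, 1, −t} with s > 1 > −t,
not a cone and not biregular) has t ≤ 29. -/
theorem H'_st_t_le_29
    {V : Type} [Fintype V] [DecidableEq V] (Γ : SimpleGraph V) [DecidableRel Γ.Adj]
    (s t : ℝ)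
    (hconn : Γ.Connected)
    (hnonreg : ¬ ∃ k, Γ.IsRegularOfDegree k)
    (hs : 1 < s) (ht : -t < 1)
    (hspec : spectrum ℝ (Γ.adjMatrix ℝ) = {s, 1, -t})
    (hnotcone : ¬ ∃ v : V, Γ.degree v = Fintype.card V - 1)
    (hnotbireg : ((Finset.univ : Finset V).image (fun v => Γ.degree v)).card ≠ 2) :
    t ≤ 29 := by
  obtain ⟨α, h⟩ := ThreeEigenvalues.exists_decomposition hconn hs ht hspec
  have := hconn.nonempty
  have hcone : ∀ x, ∃ z, z ≠ x ∧ ¬ Γ.Adj x z := by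
    intro x
    by_contra! hcon
    refine hnotcone ⟨x, ?_⟩
    rw [← SimpleGraph.card_neighborFinset_eq_degree, ← Finset.card_univ,
      ← Finset.card_erase_of_mem (Finset.mem_univ x)]
    congr 1
    ext z
    simp only [SimpleGraph.mem_neighborFinset, Finset.mem_erase, Finset.mem_univ, and_true]
    exact ⟨fun hz => hz.ne', hcon z⟩
  obtain ⟨x₀⟩ := hconn.nonempty
  obtain ⟨z₀, hne, hadj⟩ := hcone x₀
  obtain ⟨k, hk⟩ := h.exists_int hne.symm hadj
  by_contra! hlt
  have ht30 : 30 ≤ t := by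
    rw [hk] at hlt ⊢
    have : (29 : ℤ) < k := by exact_mod_cast hlt
    exact_mod_cast this
  have hdeg : ∀ {u v}, α u = α v → Γ.degree u = Γ.degree v := fun {u v} huv => by
    have h1 := h.degree u
    rw [huv, ← h.degree v] at h1
    rw [← SimpleGraph.card_neighborFinset_eq_degree, ← SimpleGraph.card_neighborFinset_eq_degree]
    exact_mod_cast h1
  have hreg : ∃ x y, α y < α x := by
    by_contra! hcon
    exact hnonreg ⟨Γ.degree x₀, fun v => hdeg (le_antisymm (hcon v x₀) (hcon x₀ v))⟩
  have hbireg : ∀ a b, ∃ z, α z ≠ a ∧ α z ≠ b := by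
    intro a b
    obtain ⟨x, y, hyx⟩ := hreg
    by_contra! hcon
    refine hnotbireg (Finset.card_eq_two.2 ⟨Γ.degree x, Γ.degree y, ?_, ?_⟩)
    · rw [← SimpleGraph.card_neighborFinset_eq_degree,
        ← SimpleGraph.card_neighborFinset_eq_degree]
      intro e
      have h1 := h.degree x
      rw [e, h.degree y] at h1
      nlinarith [h.pos x, h.pos y]
    · have hz : ∀ z, α z = α x ∨ α z = α y := by
        intro z
        have hx := hcon x
        have hy := hcon y
        have hz := hcon z
        grind
      ext d
      simp only [Finset.mem_image, Finset.mem_univ, true_and, Finset.mem_insert,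
        Finset.mem_singleton]
      constructor
      · rintro ⟨z, rfl⟩
        exact (hz z).imp hdeg hdeg
      · rintro (rfl | rfl)
        exacts [⟨x, rfl⟩, ⟨y, rfl⟩]
  exact h.false_of_gap ht30 (fun x y => h.add_one_le hk) (fun v => h.gap hs ht30 v) hcone hreg
    hbireg
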